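/- Let d = 3, assume b is twice continuously differentiable on the open set Σ_{2,χ}, and assume the set {σ ∈ Σ2 : the Fréchet derivative Db(σ) : ℝ³ → ℂ is not of the form x ↦ c·⟨π_σ ν, x⟩ for any c ∈ ℂ} is dense in Σ2. Then every continuous solution g : ℝ³ → ℂ of the homogeneous system satisfies g(y) = 0 for all y ∈ Y1 ∪ Y2. -/

import Mathlib

open Set MeasureTheory
open scoped RealInnerProductSpace

noncomputable section

abbrev Euc (d : ℕ) := EuclideanSpace ℝ (Fin d)

/-- Reflection across the hyperplane `ν^⊥` (Householder transform). -/
def Hr {d : ℕ} (ν x : Euc d) : Euc d := x - (2 * ⟪x, ν⟫) • ν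

/-- Open hemisphere of radius `k0` in direction `v`. -/
def Shemi {d : ℕ} (k0 : ℝ) (v : Euc d) : Set (Euc d) := {x | ‖x‖ = k0 ∧ 0 < ⟪x, v⟫}

def Sig1 {d : ℕ} (k0 : ℝ) (ν ω : Euc d) : Set (Euc d) :=
  {σ | σ ∈ Shemi k0 ω ∧ Hr ν σ ∉ Shemi k0 ω}

def Sig2 {d : ℕ} (k0 : ℝ) (ν ω : Euc d) : Set (Euc d) :=
  {σ | σ ∈ Shemi k0 ω ∧ Hr ν σ ∈ Shemi k0 ω}

def Y1set {d : ℕ} (k0 : ℝ) (ν ω e : Euc d) : Set (Euc d) :=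
  {y | ∃ η ∈ Shemi k0 e, ∃ σ ∈ Sig1 k0 ν ω, y = η - σ}

def Y2set {d : ℕ} (k0 : ℝ) (ν ω e : Euc d) : Set (Euc d) :=
  {y | ∃ η ∈ Shemi k0 e, ∃ σ ∈ Sig2 k0 ν ω, y = η - σ}

def Sig2chi {d : ℕ} (k0 χ : ℝ) (ν ω : Euc d) : Set (Euc d) :=
  {x | ∃ σ ∈ Sig2 k0 ν ω, ∃ t ∈ Set.Ioo (1 - χ) (1 + χ), x = t • σ}

/-- The hypotheses on the coefficient function `b`. -/
def BHyp {d : ℕ} (k0 χ : ℝ) (ν ω : Euc d) (b : Euc d → ℂ) : Prop :=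
  (∀ x ∈ Sig2chi k0 χ ν ω, b x ≠ 0) ∧
  ∀ σ ∈ Sig2 k0 ν ω, ∀ t ∈ Set.Ioo (1 - χ) (1 + χ), b (t • σ) = b σ

/-- `g` solves the homogeneous system. -/
def SolvesHom {d : ℕ} (k0 : ℝ) (ν ω e : Euc d) (b g : Euc d → ℂ) : Prop :=
  ∀ η ∈ Shemi k0 e,
    (∀ σ ∈ Sig1 k0 ν ω, g (η - σ) = 0) ∧
    ∀ σ ∈ Sig2 k0 ν ω, b σ * g (η - σ) + g (η - Hr ν σ) = 0

/-- The coupling set `F_y`. -/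
def Fcoup {d : ℕ} (k0 : ℝ) (ν ω e : Euc d) (y : Euc d) : Set (Euc d) :=
  {z | ∃ η ∈ Shemi k0 e, ∃ σ ∈ Sig2 k0 ν ω, y = η - σ ∧ z = η - Hr ν σ}

/-- The set `C_{y,λ}`. -/
def Cset {d : ℕ} (k0 : ℝ) (ν ω e : Euc d) (y : Euc d) (lam : ℝ) : Set (Euc d) :=
  {σ | σ ∈ Sig2 k0 ν ω ∧ σ + y ∈ Shemi k0 e ∧ ⟪σ, ν⟫ = lam}

/-- The `d`-th standard basis vector. -/
def eLast (d : ℕ) (hd : 0 < d) : Euc d :=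
  EuclideanSpace.single ⟨d - 1, Nat.sub_lt hd one_pos⟩ 1

def e2 : Euc 2 := EuclideanSpace.single 1 1
def e3 : Euc 3 := EuclideanSpace.single 2 1

/-- Degenerate points. -/
def degS {d : ℕ} (k0 : ℝ) (ν ω e : Euc d) : Set (Euc d) :=
  {y | ∃ η ∈ Shemi k0 e, ∃ σ ∈ Sig2 k0 ν ω, (⟪η, ν⟫ = 0 ∨ ⟪σ, ν⟫ = 0) ∧ y = η - σ}

/-- Non-degenerate points `Y2'`. -/
def Y2nd {d : ℕ} (k0 : ℝ) (ν ω e : Euc d) : Set (Euc d) :=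
  (Y2set k0 ν ω e ∩ {x | ‖x‖ < 2 * k0}) \
    (degS k0 ν ω e ∪ {x | ⟪x, ν⟫ = 0} ∪ {x | ∃ t : ℝ, x = t • ν})

/-- The set `Ỹ`. -/
def Ytil {d : ℕ} (k0 : ℝ) (ν ω e : Euc d) : Set (Euc d) :=
  {y | ∃ η ∈ Shemi k0 e, -η ∈ Sig1 k0 ν ω ∧
    ∃ σ ∈ Sig2 k0 ν ω, σ ∈ Shemi k0 (-e) ∧ Hr ν σ ∉ Shemi k0 (-e) ∧ y = η - Hr ν σ}

/-- Cross product on `Euc 3`. -/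
def cross3 (a b : Euc 3) : Euc 3 :=
  (EuclideanSpace.equiv (Fin 3) ℝ).symm
    ![a 1 * b 2 - a 2 * b 1, a 2 * b 0 - a 0 * b 2, a 0 * b 1 - a 1 * b 0]

end

theorem HasStrictDerivAt.hasDerivAt_of_comp_eventuallyEq {φ f : ℝ → ℂ} {h : ℝ → ℝ} {h' : ℝ} {f' : ℂ}
    (hh : HasStrictDerivAt h h' 0) (hh' : h' ≠ 0) (h0 : h 0 = 0) (hf : HasDerivAt f f' 0)
    (he : ∀ᶠ s in nhds 0, φ (h s) = f s) : HasDerivAt φ (h'⁻¹ • f') 0 := by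
  have hi := hh.to_localInverse hh'
  have hr := hh.eventually_right_inverse hh'
  have hi0 : hh.localInverse h h' 0 hh' (h 0) = 0 :=
    (hh.eventually_left_inverse hh').self_of_nhds
  rw [h0] at hi hr hi0
  have hc : HasDerivAt (f ∘ hh.localInverse h h' 0 hh') (h'⁻¹ • f') 0 := by
    apply HasDerivAt.scomp (g₁ := f) (g₁' := f') (h := hh.localInverse h h' 0 hh') (x := 0)
    · rwa [hi0]
    · exact hi.hasDerivAt
  refine hc.congr_of_eventuallyEq ?_
  have ht := hi.hasDerivAt.continuousAt.tendsto
  rw [hi0] at ht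
  filter_upwards [hr, ht.eventually he] with x hx hx'
  rw [Function.comp_apply, ← hx', hx]

theorem deriv_cross_mul_eq {φ f₁ f₂ : ℝ → ℂ} {h₁ h₂ : ℝ → ℝ} {h₁' h₂' : ℝ} {f₁' f₂' : ℂ}
    (hh₁ : HasStrictDerivAt h₁ h₁' 0) (hh₂ : HasStrictDerivAt h₂ h₂' 0)
    (h₁0 : h₁ 0 = 0) (h₂0 : h₂ 0 = 0)
    (hf₁ : HasDerivAt f₁ f₁' 0) (hf₂ : HasDerivAt f₂ f₂' 0)
    (he₁ : ∀ᶠ s in nhds 0, φ (h₁ s) = f₁ s) (he₂ : ∀ᶠ s in nhds 0, φ (h₂ s) = f₂ s) :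
    f₁' * h₂' = f₂' * h₁' := by
  have key : ∀ {f : ℝ → ℂ} {h : ℝ → ℝ} {h' : ℝ} {f' K : ℂ}, HasStrictDerivAt h h' 0 → h 0 = 0 →
      HasDerivAt f f' 0 → (∀ᶠ s in nhds 0, φ (h s) = f s) → HasDerivAt φ K 0 → f' = h' * K := by
    intro f h h' f' K hh h0 hf he hK
    have h1 : HasDerivAt (φ ∘ h) (h' • K) 0 := by
      apply HasDerivAt.scomp (g₁ := φ) (g₁' := K) (h := h) (x := 0)
      · rwa [h0]
      · exact hh.hasDerivAt
    have h2 : HasDerivAt (φ ∘ h) f' 0 := hf.congr_of_eventuallyEq he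
    rw [h2.unique h1, Complex.real_smul]
  by_cases z1 : h₁' = 0
  · by_cases z2 : h₂' = 0
    · simp [z1, z2]
    · have hK := hh₂.hasDerivAt_of_comp_eventuallyEq z2 h₂0 hf₂ he₂
      linear_combination (h₂' : ℂ) * key hh₁ h₁0 hf₁ he₁ hK - h₁' * key hh₂ h₂0 hf₂ he₂ hK
  · have hK := hh₁.hasDerivAt_of_comp_eventuallyEq z1 h₁0 hf₁ he₁
    linear_combination (h₂' : ℂ) * key hh₁ h₁0 hf₁ he₁ hK - h₁' * key hh₂ h₂0 hf₂ he₂ hK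

theorem quartic_coeffs_eq_zero {c0 c1 c2 c3 c4 : ℂ}
    (h : ∀ᶠ s : ℝ in nhds 0, c0 + c1 * s + c2 * s ^ 2 + c3 * s ^ 3 + c4 * s ^ 4 = 0) :
    c0 = 0 ∧ c1 = 0 ∧ c2 = 0 ∧ c3 = 0 ∧ c4 = 0 := by
  let p : Polynomial ℂ := Polynomial.C c0 + Polynomial.C c1 * Polynomial.X +
    Polynomial.C c2 * Polynomial.X ^ 2 + Polynomial.C c3 * Polynomial.X ^ 3 +
    Polynomial.C c4 * Polynomial.X ^ 4
  have hinf : Set.Infinite {s : ℝ | c0 + c1 * s + c2 * s ^ 2 + c3 * s ^ 3 + c4 * s ^ 4 = 0} :=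
    infinite_of_mem_nhds 0 h
  have hp : p = 0 := by
    apply Polynomial.eq_zero_of_infinite_isRoot
    refine (hinf.image (Complex.ofReal_injective.injOn)).mono ?_
    rintro _ ⟨s, hs, rfl⟩
    simpa [p, Polynomial.IsRoot] using hs
  have hc : ∀ n, p.coeff n = 0 := fun n => by rw [hp, Polynomial.coeff_zero]
  refine ⟨?_, ?_, ?_, ?_, ?_⟩
  · simpa [p, Polynomial.coeff_X, Polynomial.coeff_C, Polynomial.coeff_X_pow] using hc 0
  · simpa [p, Polynomial.coeff_X, Polynomial.coeff_C, Polynomial.coeff_X_pow] using hc 1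
  · simpa [p, Polynomial.coeff_X, Polynomial.coeff_C, Polynomial.coeff_X_pow] using hc 2
  · simpa [p, Polynomial.coeff_X, Polynomial.coeff_C, Polynomial.coeff_X_pow] using hc 3
  · simpa [p, Polynomial.coeff_X, Polynomial.coeff_C, Polynomial.coeff_X_pow] using hc 4

theorem exists_mem_sphere_inner_ne_zero {E : Type*} [NormedAddCommGroup E] [InnerProductSpace ℝ E]
    {k : ℝ} (hk : 0 < k) {p v : E} (hp : ‖p‖ = k) (hv : v ≠ 0) {U : Set E} (hU : U ∈ nhds p) :
    ∃ x ∈ U, ‖x‖ = k ∧ ⟪x, v⟫ ≠ 0 := by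
  by_cases h : ⟪p, v⟫ = 0
  · have hp0 : p ≠ 0 := by rintro rfl; simp at hp; linarith
    let x : ℝ → E := fun t => (k * ‖p + t • v‖⁻¹) • (p + t • v)
    have hx0 : x 0 = p := by simp [x, hp, hk.ne']
    have hc : ContinuousAt x 0 := by
      have : ‖p + (0 : ℝ) • v‖ ≠ 0 := by simpa using hp0
      fun_prop (disch := assumption)
    have hev : ∀ᶠ t in nhdsWithin (0 : ℝ) {0}ᶜ, x t ∈ U :=
      (hc.eventually (by rwa [hx0])).filter_mono nhdsWithin_le_nhds
    obtain ⟨t, htU, ht⟩ := (hev.and self_mem_nhdsWithin).exists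
    have ht : t ≠ 0 := ht
    have hin : ⟪p + t • v, v⟫ ≠ 0 := by
      rw [inner_add_left, h, inner_smul_left]
      simp [ht, hv]
    have hne : ‖p + t • v‖ ≠ 0 := by
      rw [norm_ne_zero_iff]; intro h0; rw [h0] at hin; simp at hin
    refine ⟨x t, htU, ?_, ?_⟩
    · simp only [x, norm_smul, norm_mul, norm_inv, norm_norm, Real.norm_of_nonneg hk.le]
      field_simp
    · simp only [x, inner_smul_left]
      simp only [conj_trivial]
      positivity
  · exact ⟨p, mem_of_mem_nhds hU, hp, h⟩

theorem inner_euc3 (a b : Euc 3) : ⟪a, b⟫ = a 0 * b 0 + a 1 * b 1 + a 2 * b 2 := by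
  simp [PiLp.inner_apply, Fin.sum_univ_three, mul_comm]

@[simp] theorem cross3_zero (a b : Euc 3) : cross3 a b 0 = a 1 * b 2 - a 2 * b 1 := rfl
@[simp] theorem cross3_one (a b : Euc 3) : cross3 a b 1 = a 2 * b 0 - a 0 * b 2 := rfl
@[simp] theorem cross3_two (a b : Euc 3) : cross3 a b 2 = a 0 * b 1 - a 1 * b 0 := rfl

theorem euc3_ext {a b : Euc 3} (h0 : a 0 = b 0) (h1 : a 1 = b 1) (h2 : a 2 = b 2) : a = b := by
  ext i; fin_cases i <;> assumption

/-- `cross3` as a linear map in its first argument. -/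
noncomputable def cross3L (σ : Euc 3) : Euc 3 →ₗ[ℝ] Euc 3 where
  toFun η := cross3 η σ
  map_add' a b := by apply euc3_ext <;> simp <;> ring
  map_smul' r a := by apply euc3_ext <;> simp <;> ring

@[simp] theorem cross3L_apply (σ η : Euc 3) : cross3L σ η = cross3 η σ := rfl

theorem orthogonal_frame_expansion (σ ν x : Euc 3) :
    (⟪σ, σ⟫ * (⟪ν, ν⟫ * ⟪σ, σ⟫ - ⟪ν, σ⟫ ^ 2)) • x =
      ((⟪ν, ν⟫ * ⟪σ, σ⟫ - ⟪ν, σ⟫ ^ 2) * ⟪x, σ⟫) • σ +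
      ⟪x, ⟪σ, σ⟫ • ν - ⟪ν, σ⟫ • σ⟫ • (⟪σ, σ⟫ • ν - ⟪ν, σ⟫ • σ) +
      (⟪σ, σ⟫ * ⟪x, cross3 ν σ⟫) • cross3 ν σ := by
  simp only [inner_euc3]
  apply euc3_ext <;> simp <;> ring

/-- Simultaneous rotation of `a` and `b` about the axis `a - b`, rationally parametrized:
the position of `a`. -/
noncomputable def pairRot (a b : Euc 3) (s : ℝ) : Euc 3 :=
  (1 / 2 : ℝ) • (a - b) +
    ((1 - ‖a - b‖ ^ 2 * s ^ 2) / (1 + ‖a - b‖ ^ 2 * s ^ 2)) • (1 / 2 : ℝ) • (a + b) +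
    (2 * s / (1 + ‖a - b‖ ^ 2 * s ^ 2)) • cross3 a b

theorem pairRot_zero (a b : Euc 3) : pairRot a b 0 = a := by
  simp only [pairRot]; apply euc3_ext <;> simp <;> ring

theorem norm_sq_pairRot {a b : Euc 3} {k : ℝ} (ha : ‖a‖ = k) (hb : ‖b‖ = k) (s : ℝ) :
    ‖pairRot a b s‖ ^ 2 = k ^ 2 ∧ ‖pairRot a b s - (a - b)‖ ^ 2 = k ^ 2 := by
  have h1 : a 0 * a 0 + a 1 * a 1 + a 2 * a 2 = k ^ 2 := by
    rw [← inner_euc3, real_inner_self_eq_norm_sq, ha]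
  have h2 : b 0 * b 0 + b 1 * b 1 + b 2 * b 2 = k ^ 2 := by
    rw [← inner_euc3, real_inner_self_eq_norm_sq, hb]
  have hN : ‖a - b‖ ^ 2 = 2 * k ^ 2 - 2 * (a 0 * b 0 + a 1 * b 1 + a 2 * b 2) := by
    rw [← real_inner_self_eq_norm_sq, inner_euc3]; simp; linear_combination h1 + h2
  have hd : 1 + ‖a - b‖ ^ 2 * s ^ 2 ≠ 0 := by positivity
  have hc : ((1 - ‖a - b‖ ^ 2 * s ^ 2) / (1 + ‖a - b‖ ^ 2 * s ^ 2)) ^ 2 +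
      ‖a - b‖ ^ 2 * (2 * s / (1 + ‖a - b‖ ^ 2 * s ^ 2)) ^ 2 = 1 := by
    field_simp; ring
  unfold pairRot
  generalize (1 - ‖a - b‖ ^ 2 * s ^ 2) / (1 + ‖a - b‖ ^ 2 * s ^ 2) = u at *
  generalize (2 * s / (1 + ‖a - b‖ ^ 2 * s ^ 2)) = w at *
  rw [hN] at hc
  have hX : (a 1 * b 2 - a 2 * b 1) ^ 2 + (a 2 * b 0 - a 0 * b 2) ^ 2 + (a 0 * b 1 - a 1 * b 0) ^ 2 =
      k ^ 2 * k ^ 2 - (a 0 * b 0 + a 1 * b 1 + a 2 * b 2) ^ 2 := by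
    linear_combination (b 0 * b 0 + b 1 * b 1 + b 2 * b 2) * h1 + k ^ 2 * h2
  constructor
  · rw [← real_inner_self_eq_norm_sq, inner_euc3]
    simp
    linear_combination (1 / 4 + u / 2 + u ^ 2 / 4) * h1 + (1 / 4 - u / 2 + u ^ 2 / 4) * h2 +
      w ^ 2 * hX + (k ^ 2 / 2 + (a 0 * b 0 + a 1 * b 1 + a 2 * b 2) / 2) * hc
  · rw [← real_inner_self_eq_norm_sq, inner_euc3]
    simp
    linear_combination (1 / 4 - u / 2 + u ^ 2 / 4) * h1 + (1 / 4 + u / 2 + u ^ 2 / 4) * h2 +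
      w ^ 2 * hX + (k ^ 2 / 2 + (a 0 * b 0 + a 1 * b 1 + a 2 * b 2) / 2) * hc

theorem norm_pairRot {a b : Euc 3} {k : ℝ} (hk : 0 ≤ k) (ha : ‖a‖ = k) (hb : ‖b‖ = k) (s : ℝ) :
    ‖pairRot a b s‖ = k :=
  (sq_eq_sq₀ (norm_nonneg _) hk).1 (norm_sq_pairRot ha hb s).1

theorem norm_pairRot_sub {a b : Euc 3} {k : ℝ} (hk : 0 ≤ k) (ha : ‖a‖ = k) (hb : ‖b‖ = k) (s : ℝ) :
    ‖pairRot a b s - (a - b)‖ = k :=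
  (sq_eq_sq₀ (norm_nonneg _) hk).1 (norm_sq_pairRot ha hb s).2

theorem hasStrictDerivAt_pairRot (a b : Euc 3) :
    HasStrictDerivAt (pairRot a b) ((2 : ℝ) • cross3 a b) 0 := by
  have hN : HasStrictDerivAt (fun s : ℝ => ‖a - b‖ ^ 2 * s ^ 2) 0 0 := by
    simpa using ((hasStrictDerivAt_id (0 : ℝ)).pow 2).const_mul (‖a - b‖ ^ 2)
  have hd : (1 : ℝ) + ‖a - b‖ ^ 2 * 0 ^ 2 ≠ 0 := by simp
  have hu := (hN.const_sub 1).div (hN.const_add 1) hd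
  have hw := ((hasStrictDerivAt_id (0 : ℝ)).const_mul 2).div (hN.const_add 1) hd
  have := ((hu.smul_const ((1 / 2 : ℝ) • (a + b))).const_add ((1 / 2 : ℝ) • (a - b))).add
    (hw.smul_const (cross3 a b))
  exact HasStrictDerivAt.congr_deriv (f := pairRot a b) this (by simp)

theorem conic_coeffs {c0 c1 c2 c11 c12 c22 : ℂ} {N : ℝ} (hN : N ≠ 0) (hN0 : 0 ≤ N)
    (h : ∀ᶠ s : ℝ in nhds 0, ∀ u w : ℝ, u = (1 - N * s ^ 2) / (1 + N * s ^ 2) →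
      w = 2 * s / (1 + N * s ^ 2) →
      c0 + c1 * u + c2 * w + c11 * u ^ 2 + c12 * u * w + c22 * w ^ 2 = 0) :
    c1 = 0 ∧ c2 = 0 ∧ c12 = 0 ∧ c11 = -c0 ∧ c22 = -N * c0 := by
  have h' : ∀ᶠ s : ℝ in nhds 0, (c0 + c1 + c11) + (2 * c2 + 2 * c12) * s +
      (2 * N * c0 - 2 * N * c11 + 4 * c22) * s ^ 2 + (2 * N * c2 - 2 * N * c12) * s ^ 3 +
      (N ^ 2 * (c0 - c1 + c11)) * s ^ 4 = 0 := by
    filter_upwards [h] with s hs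
    have hs := hs _ _ rfl rfl
    have hd : (1 : ℝ) + N * s ^ 2 ≠ 0 := by positivity
    have hd' : (1 : ℂ) + N * s ^ 2 ≠ 0 := by exact_mod_cast hd
    push_cast at hs
    field_simp at hs
    linear_combination hs
  obtain ⟨e0, e1, e2, e3, e4⟩ := quartic_coeffs_eq_zero h'
  have hNc : (N : ℂ) ≠ 0 := by exact_mod_cast hN
  have e4' : c0 - c1 + c11 = 0 := by simpa [hN] using e4
  have e3' : c2 - c12 = 0 := by
    have : (2 * N : ℂ) * (c2 - c12) = 0 := by linear_combination e3
    simpa [hN] using this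
  have hc1 : c1 = 0 := by linear_combination (e0 - e4') / 2
  have hc11 : c11 = -c0 := by linear_combination (e0 + e4') / 2
  refine ⟨hc1, by linear_combination e1 / 4 + e3' / 2, by linear_combination e1 / 4 - e3' / 2,
    hc11, ?_⟩
  rw [hc11] at e2
  linear_combination e2 / 4

theorem exists_plane_coords {a b x : Euc 3} {k : ℝ} (ha : ‖a‖ = k) (hb : ‖b‖ = k)
    (hab : a ≠ b) (hlt : ‖a - b‖ ^ 2 < 4 * k ^ 2) (hx : ⟪x, a - b⟫ = ‖a - b‖ ^ 2 / 2) :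
    ∃ u w : ℝ, x = (1 / 2 : ℝ) • (a - b) + u • (1 / 2 : ℝ) • (a + b) + w • cross3 a b ∧
      ‖x‖ ^ 2 - k ^ 2 = (k ^ 2 - ‖a - b‖ ^ 2 / 4) * (u ^ 2 + ‖a - b‖ ^ 2 * w ^ 2 - 1) := by
  have h1 : ⟪a, a⟫ = k ^ 2 := by rw [real_inner_self_eq_norm_sq, ha]
  have h2 : ⟪b, b⟫ = k ^ 2 := by rw [real_inner_self_eq_norm_sq, hb]
  have hN : ⟪a - b, a - b⟫ = ‖a - b‖ ^ 2 := real_inner_self_eq_norm_sq _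
  have hN0 : ‖a - b‖ ^ 2 ≠ 0 := by
    have : a - b ≠ 0 := sub_ne_zero.2 hab
    positivity
  have hP0 : k ^ 2 - ‖a - b‖ ^ 2 / 4 ≠ 0 := by linarith
  have hxx := real_inner_self_eq_norm_sq x
  set N := ‖a - b‖ ^ 2 with hNdef
  have hNd : N = 2 * k ^ 2 - 2 * ⟪a, b⟫ := by
    rw [← hN, ← h1]; nth_rw 1 [two_mul]; nth_rw 2 [h1]; rw [← h2]
    simp only [inner_euc3]; simp; ring
  have hq : cross3 ((1 / 2 : ℝ) • (a + b)) (a - b) = -cross3 a b := by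
    apply euc3_ext <;> simp <;> ring
  have hqq : ⟪cross3 a b, cross3 a b⟫ = N * (k ^ 2 - N / 4) := by
    have : ⟪cross3 a b, cross3 a b⟫ = ⟪a, a⟫ * ⟪b, b⟫ - ⟪a, b⟫ ^ 2 := by
      simp only [inner_euc3]; simp; ring
    rw [this, h1, h2, hNd]; ring
  have hpp : ⟪(1 / 2 : ℝ) • (a + b), (1 / 2 : ℝ) • (a + b)⟫ = k ^ 2 - N / 4 := by
    have : ⟪(1 / 2 : ℝ) • (a + b), (1 / 2 : ℝ) • (a + b)⟫ = (⟪a, a⟫ + ⟪b, b⟫ + 2 * ⟪a, b⟫) / 4 := by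
      simp only [inner_euc3]; simp; ring
    rw [this, h1, h2, hNd]; ring
  have hpd : ⟪(1 / 2 : ℝ) • (a + b), a - b⟫ = 0 := by
    have : ⟪(1 / 2 : ℝ) • (a + b), a - b⟫ = (⟪a, a⟫ - ⟪b, b⟫) / 2 := by
      simp only [inner_euc3]; simp; ring
    rw [this, h1, h2]; ring
  have hyd : ⟪x - (1 / 2 : ℝ) • (a - b), a - b⟫ = 0 := by
    rw [inner_sub_left, inner_smul_left, hx, hN]; simp; ring
  have hpq : ⟪(1 / 2 : ℝ) • (a + b), cross3 a b⟫ = 0 := by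
    simp only [inner_euc3]; simp; ring
  have hdq : ⟪a - b, cross3 a b⟫ = 0 := by
    simp only [inner_euc3]; simp; ring
  have hex := orthogonal_frame_expansion (a - b) ((1 / 2 : ℝ) • (a + b)) (x - (1 / 2 : ℝ) • (a - b))
  rw [hq, hN, hpp, hpd, hyd] at hex
  have hxy : x = (1 / 2 : ℝ) • (a - b) + (x - (1 / 2 : ℝ) • (a - b)) := by abel
  generalize (1 / 2 : ℝ) • (a + b) = p at *
  generalize cross3 a b = q at *
  generalize a - b = d at *
  generalize hPd : k ^ 2 - N / 4 = P at hP0 hqq hpp hex ⊢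
  generalize x - (1 / 2 : ℝ) • d = y at *
  have hy : y = (⟪y, p⟫ / P) • p + (⟪y, q⟫ / (N * P)) • q := by
    have hne : N * (P * N) ≠ 0 := by positivity
    apply smul_right_injective _ hne
    simp only [inner_sub_right, inner_smul_right, inner_neg_right, hyd] at hex
    simp only [smul_add, smul_smul]
    convert hex using 1
    · congr 1; ring
    · rw [show N * (P * N) * (⟪y, p⟫ / P) = N * N * ⟪y, p⟫ by field_simp,
        show N * (P * N) * (⟪y, q⟫ / (N * P)) = N * ⟪y, q⟫ by field_simp]
      module
  refine ⟨⟪y, p⟫ / P, ⟪y, q⟫ / (N * P), ?_, ?_⟩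
  · rw [add_assoc, ← hy]; exact hxy
  · generalize ⟪y, p⟫ / P = u at hy ⊢
    generalize ⟪y, q⟫ / (N * P) = w at hy ⊢
    have hdp : ⟪d, p⟫ = 0 := by rw [real_inner_comm, hpd]
    have hqd : ⟪q, d⟫ = 0 := by rw [real_inner_comm, hdq]
    have hqp : ⟪q, p⟫ = 0 := by rw [real_inner_comm, hpq]
    rw [← hxx, hxy, hy]
    simp only [inner_add_left, inner_add_right, inner_smul_left, inner_smul_right, hN, hpp, hqq,
      hpd, hdp, hdq, hqd, hpq, hqp, conj_trivial]
    linear_combination -hPd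

theorem bilinear_eq_on_plane {a b : Euc 3} {k : ℝ} (hk : 0 ≤ k) (ha : ‖a‖ = k) (hb : ‖b‖ = k)
    (hab : a ≠ b) (hlt : ‖a - b‖ ^ 2 < 4 * k ^ 2) (A B A' B' : Euc 3 →ₗ[ℝ] ℂ)
    (h : ∀ᶠ s in nhds 0, A (pairRot a b s) * B (pairRot a b s - (a - b)) =
      A' (pairRot a b s - (a - b)) * B' (pairRot a b s))
    {x₀ : Euc 3} (hx₀ : ⟪x₀, a - b⟫ = ‖a - b‖ ^ 2 / 2) (hx₀k : ‖x₀‖ ≠ k)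
    (hA : A x₀ = 0) (hB : B' x₀ = 0) {x : Euc 3} (hx : ⟪x, a - b⟫ = ‖a - b‖ ^ 2 / 2) :
    A x * B (x - (a - b)) = A' (x - (a - b)) * B' x := by
  set d := a - b
  set p := (1 / 2 : ℝ) • (a + b)
  set q := cross3 a b
  have hsub : ∀ u w : ℝ, (1 / 2 : ℝ) • d + u • p + w • q - d =
      (-1 / 2 : ℝ) • d + u • p + w • q := by intro u w; module
  have hexp : ∀ (T : Euc 3 →ₗ[ℝ] ℂ) (r u w : ℝ), T (r • d + u • p + w • q) =
      r * T d + u * T p + w * T q := by intro T r u w; simp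
  have key : ∀ u w : ℝ, A ((1 / 2 : ℝ) • d + u • p + w • q) *
        B ((1 / 2 : ℝ) • d + u • p + w • q - d) -
      A' ((1 / 2 : ℝ) • d + u • p + w • q - d) * B' ((1 / 2 : ℝ) • d + u • p + w • q) =
      (A' d * B' d - A d * B d) / 4 +
      ((A d * B p - A p * B d) / 2 - (A' p * B' d - A' d * B' p) / 2) * u +
      ((A d * B q - A q * B d) / 2 - (A' q * B' d - A' d * B' q) / 2) * w +
      (A p * B p - A' p * B' p) * u ^ 2 +
      (A p * B q + A q * B p - A' p * B' q - A' q * B' p) * u * w +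
      (A q * B q - A' q * B' q) * w ^ 2 := by
    intro u w
    rw [hsub, hexp, hexp, hexp, hexp]; push_cast; ring
  have hd0 : d ≠ 0 := sub_ne_zero.2 hab
  have hN0 : ‖d‖ ^ 2 ≠ 0 := by positivity
  have hcoef := conic_coeffs hN0 (by positivity) (c0 := (A' d * B' d - A d * B d) / 4)
    (c1 := (A d * B p - A p * B d) / 2 - (A' p * B' d - A' d * B' p) / 2)
    (c2 := (A d * B q - A q * B d) / 2 - (A' q * B' d - A' d * B' q) / 2)
    (c11 := A p * B p - A' p * B' p) (c12 := A p * B q + A q * B p - A' p * B' q - A' q * B' p)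
    (c22 := A q * B q - A' q * B' q) (by
      filter_upwards [h] with s hs u w hu hw
      rw [← key, hu, hw]
      exact sub_eq_zero.2 hs)
  obtain ⟨e1, e2, e12, e11, e22⟩ := hcoef
  rw [e1, e2, e12, e11, e22] at key
  generalize (A' d * B' d - A d * B d) / 4 = c at *
  have hc : c = 0 := by
    obtain ⟨u, w, hxe, hn⟩ := exists_plane_coords ha hb hab hlt hx₀
    have hne : u ^ 2 + ‖d‖ ^ 2 * w ^ 2 - 1 ≠ 0 := by
      intro h0
      rw [h0, mul_zero, sub_eq_zero] at hn
      exact hx₀k ((sq_eq_sq₀ (norm_nonneg _) hk).1 hn)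
    have hk' := key u w
    rw [← hxe, hA, hB] at hk'
    have hne' : (u : ℂ) ^ 2 + (‖d‖ : ℂ) ^ 2 * w ^ 2 - 1 ≠ 0 := by exact_mod_cast hne
    have : c * ((u : ℂ) ^ 2 + (‖d‖ : ℂ) ^ 2 * w ^ 2 - 1) = 0 := by
      push_cast at hk'
      linear_combination hk'
    simpa [hne'] using this
  obtain ⟨u, w, hxe, -⟩ := exists_plane_coords ha hb hab hlt hx
  have hk' := key u w
  rw [← hxe, hc] at hk'
  linear_combination hk'

section Reflection

variable {d : ℕ} {ν : Euc d}

theorem Hr_sub (x y : Euc d) : Hr ν (x - y) = Hr ν x - Hr ν y := by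
  simp only [Hr, inner_sub_left]; module

theorem norm_Hr (hν : ‖ν‖ = 1) (x : Euc d) : ‖Hr ν x‖ = ‖x‖ := by
  rw [← sq_eq_sq₀ (norm_nonneg _) (norm_nonneg _), Hr, norm_sub_sq_real, norm_smul, hν,
    inner_smul_right, mul_one, Real.norm_eq_abs, sq_abs]
  ring

theorem Hr_Hr (hν : ‖ν‖ = 1) (x : Euc d) : Hr ν (Hr ν x) = x := by
  simp only [Hr, inner_sub_left, inner_smul_left, real_inner_self_eq_norm_sq, hν, conj_trivial]
  module

theorem continuous_Hr : Continuous (Hr ν) := by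
  unfold Hr; fun_prop

theorem mem_Sig2_iff (hν : ‖ν‖ = 1) {k : ℝ} {ω σ : Euc d} :
    σ ∈ Sig2 k ν ω ↔ ‖σ‖ = k ∧ 0 < ⟪σ, ω⟫ ∧ 0 < ⟪Hr ν σ, ω⟫ := by
  simp only [Sig2, Shemi, mem_ofPred_eq, norm_Hr hν]; tauto

theorem Sig2chi_mem_nhds (hν : ‖ν‖ = 1) {k χ : ℝ} (hk : 0 < k) (hχ : χ ∈ Ioo (0 : ℝ) 1)
    {ω σ : Euc d} (hσ : σ ∈ Sig2 k ν ω) : Sig2chi k χ ν ω ∈ nhds σ := by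
  obtain ⟨h1, h2, h3⟩ := (mem_Sig2_iff hν).1 hσ
  have hH := continuous_Hr (ν := ν)
  have e1 : ∀ᶠ x in nhds σ, 0 < ⟪x, ω⟫ :=
    continuousAt_const.eventually_lt (by fun_prop) h2
  have e2 : ∀ᶠ x in nhds σ, 0 < ⟪Hr ν x, ω⟫ :=
    continuousAt_const.eventually_lt (by fun_prop) h3
  have e3 : ∀ᶠ x in nhds σ, k * (1 - χ) < ‖x‖ :=
    continuousAt_const.eventually_lt (by fun_prop) (by rw [h1]; nlinarith [hχ.1])
  have e4 : ∀ᶠ x in nhds σ, ‖x‖ < k * (1 + χ) :=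
    ContinuousAt.eventually_lt (by fun_prop) continuousAt_const (by rw [h1]; nlinarith [hχ.1])
  filter_upwards [e1, e2, e3, e4] with x x1 x2 x3 x4
  have hx : 0 < ‖x‖ := by nlinarith [hχ.2]
  have hs : Hr ν ((k / ‖x‖) • x) = (k / ‖x‖) • Hr ν x := by
    simp only [Hr, inner_smul_left, conj_trivial]; module
  refine ⟨(k / ‖x‖) • x, (mem_Sig2_iff hν).2 ⟨?_, ?_, ?_⟩, ‖x‖ / k, ⟨?_, ?_⟩, ?_⟩
  · rw [norm_smul, Real.norm_of_nonneg (by positivity)]; field_simp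
  · rw [inner_smul_left]; simp only [conj_trivial]; positivity
  · rw [hs, inner_smul_left]; simp only [conj_trivial]; positivity
  · rw [lt_div_iff₀ hk]; linarith
  · rw [div_lt_iff₀ hk]; linarith
  · rw [smul_smul, show ‖x‖ / k * (k / ‖x‖) = 1 by field_simp, one_smul]

end Reflection

/-- The functional `x ↦ det (x, σ, ν)`, with complex values. -/
noncomputable def tripleL (σ ν : Euc 3) : Euc 3 →ₗ[ℝ] ℂ where
  toFun x := (⟪cross3 x σ, ν⟫ : ℝ)
  map_add' x y := by
    rw [← Complex.ofReal_add, ← inner_add_left, ← cross3L_apply, map_add]; rfl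
  map_smul' r x := by
    rw [← cross3L_apply, map_smul, inner_smul_left]; simp

theorem tripleL_apply (σ ν x : Euc 3) : tripleL σ ν x = (⟪cross3 x σ, ν⟫ : ℝ) := rfl

theorem tripleL_self (σ ν : Euc 3) : tripleL σ ν σ = 0 := by
  rw [tripleL_apply, inner_euc3]; simp; ring_nf

theorem tripleL_normal (σ ν : Euc 3) : tripleL σ ν ν = 0 := by
  rw [tripleL_apply, inner_euc3]; simp; ring_nf

theorem tripleL_Hr (σ ν x : Euc 3) : tripleL σ ν (Hr ν x) = tripleL σ ν x := by
  rw [Hr, map_sub, map_smul, tripleL_normal, smul_zero, sub_zero]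

theorem apply_normal_eq_zero {k : ℝ} (hk : 0 < k) {ν σ σ' η η' : Euc 3}
    (hσ : ‖σ‖ = k) (hη : ‖η‖ = k) (hη' : ‖η'‖ = k) (hδ : η - η' = Hr ν σ - Hr ν σ')
    (F F' : Euc 3 →ₗ[ℝ] ℂ) (hF : F σ = 0) (hlt : ‖η - η'‖ ^ 2 < 4 * k ^ 2)
    (h1 : ⟪σ, η - η'⟫ ≠ 0) (h2 : 2 * ⟪σ, η - η'⟫ - ‖η - η'‖ ^ 2 ≠ 0)
    (h3 : 2 * ⟪σ, η - η'⟫ + ‖η - η'‖ ^ 2 ≠ 0) (h4 : tripleL σ' ν σ ≠ 0)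
    (h : ∀ᶠ s in nhds 0, F (pairRot η η' s) * tripleL σ' ν (pairRot η η' s - (η - η')) =
      F' (pairRot η η' s - (η - η')) * tripleL σ ν (pairRot η η' s)) : F ν = 0 := by
  have hne : η ≠ η' := by rintro rfl; simp at h1
  have hN0 : ‖η - η'‖ ^ 2 ≠ 0 := by
    have : η - η' ≠ 0 := sub_ne_zero.2 hne
    positivity
  have hplane := fun {x₀} (hx₀ : ⟪x₀, η - η'⟫ = ‖η - η'‖ ^ 2 / 2) (hx₀k : ‖x₀‖ ≠ k)
    (hA : F x₀ = 0) (hB : tripleL σ ν x₀ = 0) {x} (hx : ⟪x, η - η'⟫ = ‖η - η'‖ ^ 2 / 2) =>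
    bilinear_eq_on_plane hk.le hη hη' hne hlt F (tripleL σ' ν) F' (tripleL σ ν) h
      hx₀ hx₀k hA hB hx
  have hdet : tripleL σ' ν (η - η') = tripleL σ' ν σ := by
    rw [hδ, map_sub, tripleL_Hr, tripleL_Hr, tripleL_self, sub_zero]
  generalize η - η' = δ at *
  have hx₀ : ⟪(‖δ‖ ^ 2 / (2 * ⟪σ, δ⟫)) • σ, δ⟫ = ‖δ‖ ^ 2 / 2 := by
    rw [inner_smul_left]; simp only [conj_trivial]; field_simp
  have hx₀k : ‖(‖δ‖ ^ 2 / (2 * ⟪σ, δ⟫)) • σ‖ ≠ k := by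
    rw [norm_smul, hσ, Real.norm_eq_abs]
    intro h0
    have h5 : |‖δ‖ ^ 2 / (2 * ⟪σ, δ⟫)| = 1 := by
      apply mul_right_cancel₀ hk.ne'; rw [h0, one_mul]
    rcases (abs_eq zero_le_one).1 h5 with h6 | h6
    · rw [div_eq_iff (by positivity)] at h6; apply h2; linarith
    · rw [div_eq_iff (by positivity)] at h6; apply h3; linarith
  have hpl := fun t : ℝ => hplane hx₀ hx₀k (by rw [map_smul, hF, smul_zero])
    (by rw [map_smul, tripleL_self, smul_zero])
    (x := (‖δ‖ ^ 2 / (2 * ⟪σ, δ⟫)) • σ + t • (ν - (⟪ν, δ⟫ / ⟪σ, δ⟫) • σ)) (by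
      rw [inner_add_left, hx₀, inner_smul_left, inner_sub_left, inner_smul_left]
      simp only [conj_trivial]; field_simp; ring)
  simp only [map_add, map_sub, map_smul, hF, tripleL_self, tripleL_normal, hdet] at hpl
  have p1 := hpl 1
  have p2 := hpl (-1)
  simp only [Complex.real_smul] at p1 p2
  push_cast at p1 p2
  have p3 : F ν * (((‖δ‖ : ℂ) ^ 2 / (2 * (⟪σ, δ⟫ : ℝ)) - 1) * tripleL σ' ν σ) = 0 := by
    linear_combination (p1 - p2) / 2
  have hx1 : (‖δ‖ : ℂ) ^ 2 / (2 * (⟪σ, δ⟫ : ℝ)) - 1 ≠ 0 := by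
    have : ‖δ‖ ^ 2 / (2 * ⟪σ, δ⟫) - 1 ≠ 0 := by
      rw [Ne, sub_eq_zero, div_eq_iff (by positivity)]
      intro h6; apply h2; linarith
    exact_mod_cast this
  exact (mul_eq_zero.1 p3).resolve_right (mul_ne_zero hx1 h4)

theorem inner_cross3_cross3 (a b c d : Euc 3) :
    ⟪cross3 a b, cross3 c d⟫ = ⟪a, c⟫ * ⟪b, d⟫ - ⟪a, d⟫ * ⟪b, c⟫ := by
  simp only [inner_euc3]; simp; ring

theorem eventually_generic {ν σ η : Euc 3} (hν : ‖ν‖ = 1)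
    (c1 : ⟪η, cross3 σ ν⟫ ≠ 0) (c2 : ⟪σ, ν⟫ ≠ 0)
    (c3 : ⟪η, ⟪σ, Hr ν σ⟫ • ν + ⟪σ, ν⟫ • σ⟫ ≠ 0) :
    ∀ᶠ s in nhdsWithin 0 {0}ᶜ, ⟪σ, η - pairRot η (Hr ν σ) s⟫ ≠ 0 ∧
      2 * ⟪σ, η - pairRot η (Hr ν σ) s⟫ - ‖η - pairRot η (Hr ν σ) s‖ ^ 2 ≠ 0 ∧
      2 * ⟪σ, η - pairRot η (Hr ν σ) s⟫ + ‖η - pairRot η (Hr ν σ) s‖ ^ 2 ≠ 0 ∧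
      ⟪cross3 σ ν, η - pairRot η (Hr ν σ) s⟫ ≠ 0 := by
  have hd := (hasStrictDerivAt_pairRot η (Hr ν σ)).hasDerivAt.const_sub η
  have hn := hd.norm_sq
  rw [pairRot_zero, sub_self, inner_zero_left, mul_zero] at hn
  have hi : ∀ v : Euc 3, HasDerivAt (fun s => ⟪v, η - pairRot η (Hr ν σ) s⟫)
      (-(2 * ⟪v, cross3 η (Hr ν σ)⟫)) 0 := by
    intro v
    have := (hasDerivAt_const (0 : ℝ) v).inner ℝ hd
    simpa [inner_smul_right, inner_neg_right] using this
  have n1 : ⟪σ, cross3 η (Hr ν σ)⟫ ≠ 0 := by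
    have : ⟪σ, cross3 η (Hr ν σ)⟫ = 2 * ⟪σ, ν⟫ * ⟪η, cross3 σ ν⟫ := by
      rw [Hr]
      generalize hc : 2 * ⟪σ, ν⟫ = c
      simp only [inner_euc3]; simp; ring
    rw [this]; positivity
  have n2 : ⟪cross3 σ ν, cross3 η (Hr ν σ)⟫ ≠ 0 := by
    have hν' : ⟪ν, Hr ν σ⟫ = -⟪σ, ν⟫ := by
      rw [Hr, inner_sub_right, inner_smul_right, real_inner_self_eq_norm_sq, hν,
        real_inner_comm]
      ring
    have : ⟪cross3 σ ν, cross3 η (Hr ν σ)⟫ = -⟪η, ⟪σ, Hr ν σ⟫ • ν + ⟪σ, ν⟫ • σ⟫ := by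
      rw [inner_cross3_cross3, hν', inner_add_right, inner_smul_right, inner_smul_right,
        real_inner_comm σ η, real_inner_comm ν η]
      ring
    rw [this]
    exact neg_ne_zero.2 c3
  have hσ' := hi σ
  have e1 := hσ'.eventually_ne (c := 0) (by simpa using n1)
  have e2 := ((hσ'.const_mul 2).sub hn).eventually_ne (c := 0) (by simpa using n1)
  have e3 := ((hσ'.const_mul 2).add hn).eventually_ne (c := 0) (by simpa using n1)
  have e4 := (hi (cross3 σ ν)).eventually_ne (c := 0) (by simpa using n2)
  filter_upwards [e1, e2, e3, e4] with s s1 s2 s3 s4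
  exact ⟨s1, s2, s3, s4⟩

theorem continuousAt_pairRot (a b : Euc 3) : ContinuousAt (pairRot a b) 0 :=
  (hasStrictDerivAt_pairRot a b).hasDerivAt.continuousAt

theorem eventually_inner_pos {d : ℕ} {f : ℝ → Euc d} {v : Euc d} (hf : ContinuousAt f 0)
    (h : 0 < ⟪f 0, v⟫) : ∀ᶠ s in nhds 0, 0 < ⟪f s, v⟫ :=
  continuousAt_const.eventually_lt (hf.inner continuousAt_const) h

theorem eventually_mem_Sig2 {d : ℕ} {k : ℝ} {ν ω : Euc d} (hν : ‖ν‖ = 1) {f : ℝ → Euc d}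
    (hf : ContinuousAt f 0) (hk : ∀ s, ‖f s‖ = k) (h : f 0 ∈ Sig2 k ν ω) :
    ∀ᶠ s in nhds 0, f s ∈ Sig2 k ν ω := by
  obtain ⟨-, h1, h2⟩ := (mem_Sig2_iff hν).1 h
  filter_upwards [eventually_inner_pos hf h1,
    eventually_inner_pos (continuous_Hr.continuousAt.comp hf) h2] with s s1 s2
  exact (mem_Sig2_iff hν).2 ⟨hk s, s1, s2⟩

section Transport

variable {k : ℝ} {ν ω e : Euc 3} {b g : Euc 3 → ℂ}

theorem exists_transport (hk : 0 < k) (hν : ‖ν‖ = 1) (hg : SolvesHom k ν ω e b g)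
    {η σ : Euc 3} (hη : η ∈ Shemi k e) (hσ : σ ∈ Sig2 k ν ω) (hb : b σ ≠ 0)
    (hbd : DifferentiableAt ℝ b σ) :
    ∃ (h : ℝ → ℝ) (f : ℝ → ℂ), HasStrictDerivAt h (4 * ⟪cross3 η σ, ν⟫) 0 ∧
      HasDerivAt f (2 * fderiv ℝ b σ (cross3 η σ) / b σ * g (η - Hr ν σ)) 0 ∧ h 0 = 0 ∧
      ∀ᶠ s in nhds 0, g (η - Hr ν σ + h s • ν) = f s := by
  have hP := hasStrictDerivAt_pairRot η σ
  have hP0 : pairRot η σ 0 - (η - σ) = σ := by rw [pairRot_zero, sub_sub_cancel]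
  have hPd := hP.hasDerivAt.sub_const (η - σ)
  have hσk := ((mem_Sig2_iff hν).1 hσ).1
  refine ⟨fun s => 2 * ⟪pairRot η σ s - η, ν⟫,
    fun s => -b (pairRot η σ s - (η - σ)) * g (η - σ), ?_, ?_, by simp [pairRot_zero], ?_⟩
  · have := ((innerSL ℝ ν).hasStrictFDerivAt.comp_hasStrictDerivAt 0
      (hP.sub_const η)).const_mul 2
    refine (this.congr_deriv ?_).congr_of_eventuallyEq (.of_forall fun s => ?_)
    · simp [real_inner_comm]; ring
    · simp [real_inner_comm]
  · have hF : HasFDerivAt b (fderiv ℝ b σ) (pairRot η σ 0 - (η - σ)) := by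
      rw [hP0]; exact hbd.hasFDerivAt
    refine ((hF.comp_hasDerivAt 0 hPd).neg.mul_const (g (η - σ))).congr_deriv ?_
    have hgσ := (hg η hη).2 σ hσ
    rw [map_smul, Complex.real_smul, Complex.ofReal_ofNat]
    field_simp
    linear_combination -fderiv ℝ b σ (cross3 η σ) * hgσ
  · have hmem := eventually_mem_Sig2 (ω := ω) hν hPd.continuousAt
      (norm_pairRot_sub hk.le hη.1 hσk) (by rwa [hP0])
    filter_upwards [hmem, eventually_inner_pos (continuousAt_pairRot η σ)
      (by rw [pairRot_zero]; exact hη.2)] with s s1 s2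
    have := (hg _ ⟨norm_pairRot hk.le hη.1 hσk s, s2⟩).2 _ s1
    rw [sub_sub_cancel] at this
    rw [neg_mul, ← eq_neg_of_add_eq_zero_right this]
    congr 1
    simp only [Hr, inner_sub_left]
    module

theorem fderiv_cross_coupling (hk : 0 < k) (hν : ‖ν‖ = 1) (hg : SolvesHom k ν ω e b g)
    (hb : ∀ σ ∈ Sig2 k ν ω, b σ ≠ 0 ∧ DifferentiableAt ℝ b σ)
    {η σ η' σ' : Euc 3} (hη : η ∈ Shemi k e) (hσ : σ ∈ Sig2 k ν ω) (hη' : η' ∈ Shemi k e)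
    (hσ' : σ' ∈ Sig2 k ν ω) (hz : η - Hr ν σ = η' - Hr ν σ') (hgz : g (η - Hr ν σ) ≠ 0) :
    fderiv ℝ b σ (cross3 η σ) / b σ * (⟪cross3 η' σ', ν⟫ : ℝ) =
      fderiv ℝ b σ' (cross3 η' σ') / b σ' * (⟪cross3 η σ, ν⟫ : ℝ) := by
  obtain ⟨h, f, h1, h2, h3, h4⟩ := exists_transport hk hν hg hη hσ (hb σ hσ).1 (hb σ hσ).2
  obtain ⟨h', f', h1', h2', h3', h4'⟩ :=
    exists_transport hk hν hg hη' hσ' (hb σ' hσ').1 (hb σ' hσ').2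
  rw [← hz] at h2' h4'
  have := deriv_cross_mul_eq (φ := fun r => g (η - Hr ν σ + r • ν)) h1 h1' h3 h3' h2 h2' h4 h4'
  apply mul_right_cancel₀ hgz
  push_cast at this
  linear_combination this / 8

/-- The functional `x ↦ Db(σ)(x × σ) / b(σ)`. -/
noncomputable def crossLogDeriv (b : Euc 3 → ℂ) (σ : Euc 3) : Euc 3 →ₗ[ℝ] ℂ :=
  (b σ)⁻¹ • ((fderiv ℝ b σ).toLinearMap ∘ₗ cross3L σ)

theorem crossLogDeriv_apply (b : Euc 3 → ℂ) (σ x : Euc 3) :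
    crossLogDeriv b σ x = fderiv ℝ b σ (cross3 x σ) / b σ := by
  simp [crossLogDeriv, div_eq_inv_mul]

theorem fderiv_cross_normal_eq_zero (hk : 0 < k) (hν : ‖ν‖ = 1) (hg : SolvesHom k ν ω e b g)
    (hgc : Continuous g) (hb : ∀ σ ∈ Sig2 k ν ω, b σ ≠ 0 ∧ DifferentiableAt ℝ b σ)
    {η₀ σ : Euc 3} (hη₀ : η₀ ∈ Shemi k e) (hσ : σ ∈ Sig2 k ν ω) (hσν : ⟪σ, ν⟫ ≠ 0)
    (hc : cross3 σ ν ≠ 0) (hg₀ : g (η₀ - Hr ν σ) ≠ 0) :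
    fderiv ℝ b σ (cross3 ν σ) = 0 := by
  have hσk := ((mem_Sig2_iff hν).1 hσ).1
  have hHσk : ‖Hr ν σ‖ = k := by rw [norm_Hr hν, hσk]
  set u := ⟪σ, Hr ν σ⟫ • ν + ⟪σ, ν⟫ • σ with hu_def
  have hu : u ≠ 0 := by
    intro hu
    have h1 : cross3 u ν = ⟪σ, ν⟫ • cross3 σ ν := by
      rw [hu_def]
      generalize ⟪σ, Hr ν σ⟫ = c
      generalize ⟪σ, ν⟫ = c'
      apply euc3_ext <;> simp <;> ring
    rw [hu, ← cross3L_apply, map_zero] at h1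
    exact smul_ne_zero hσν hc h1.symm
  have hV : IsOpen {x | 0 < ⟪x, e⟫ ∧ g (x - Hr ν σ) ≠ 0} :=
    (isOpen_lt continuous_const (by fun_prop : Continuous fun x : Euc 3 => ⟪x, e⟫)).inter
      (isOpen_ne_fun (f := fun x => g (x - Hr ν σ)) (by fun_prop) continuous_const)
  have hW : IsOpen {x : Euc 3 | ⟪x, cross3 σ ν⟫ ≠ 0} :=
    isOpen_ne_fun (by fun_prop) continuous_const
  obtain ⟨η₁, hη₁V, hη₁k, hη₁c⟩ :=
    exists_mem_sphere_inner_ne_zero hk hη₀.1 hc (hV.mem_nhds ⟨hη₀.2, hg₀⟩)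
  obtain ⟨η, ⟨⟨hηe, hηg⟩, hηc⟩, hηk, hηu⟩ := 
    exists_mem_sphere_inner_ne_zero hk hη₁k hu ((hV.inter hW).mem_nhds ⟨hη₁V, hη₁c⟩)
  have hPc := continuousAt_pairRot η (Hr ν σ)
  have hP0 := pairRot_zero η (Hr ν σ)
  have hSc : ContinuousAt
      (fun s => Hr ν (pairRot η (Hr ν σ) s - (η - Hr ν σ))) 0 :=
    continuous_Hr.continuousAt.comp (hPc.sub continuousAt_const)
  have hmem := eventually_mem_Sig2 (ω := ω) (k := k) hν hSc
    (fun s => by rw [norm_Hr hν, norm_pairRot_sub hk.le hηk hHσk])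
    (by rwa [hP0, sub_sub_cancel, Hr_Hr hν])
  have hpos := eventually_inner_pos (v := e) hPc (by rwa [hP0])
  have hlt : ∀ᶠ s in nhds 0, ‖η - pairRot η (Hr ν σ) s‖ ^ 2 < 4 * k ^ 2 := by
    refine ContinuousAt.eventually_lt ((continuousAt_const.sub hPc).norm.pow 2)
      continuousAt_const ?_
    have := pow_pos hk 2
    simpa [hP0] using this
  obtain ⟨s, ⟨n1, n2, n3, n4⟩, hσ', hη'e, hlt⟩ :=
    ((eventually_generic hν hηc hσν hηu).and
      ((hmem.and (hpos.and hlt)).filter_mono nhdsWithin_le_nhds)).exists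
  have hη'k := norm_pairRot hk.le hηk hHσk s
  have hδ : η - pairRot η (Hr ν σ) s =
      Hr ν σ - Hr ν (Hr ν (pairRot η (Hr ν σ) s - (η - Hr ν σ))) := by
    rw [Hr_Hr hν]; abel
  generalize Hr ν (pairRot η (Hr ν σ) s - (η - Hr ν σ)) = σ' at *
  generalize pairRot η (Hr ν σ) s = η' at *
  have n4' : tripleL σ' ν σ ≠ 0 := by
    have h1 : σ' = σ - Hr ν (η - η') := by rw [hδ, Hr_sub, Hr_Hr hν, Hr_Hr hν]; abel
    have h2 : ⟪cross3 σ σ', ν⟫ = ⟪cross3 σ ν, η - η'⟫ := by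
      rw [h1, Hr]
      generalize 2 * ⟪η - η', ν⟫ = c
      generalize η - η' = δ
      simp only [inner_euc3]; simp; ring
    rw [tripleL_apply, h2]
    exact_mod_cast n4
  have hF := apply_normal_eq_zero hk hσk hηk hη'k hδ (crossLogDeriv b σ) (crossLogDeriv b σ')
    (by
      have : cross3 σ σ = 0 := by apply euc3_ext <;> simp <;> ring
      rw [crossLogDeriv_apply, this, map_zero, zero_div]) hlt n1 n2 n3 n4' (by
    have hQc := continuousAt_pairRot η η'
    have hQ0 := pairRot_zero η η'
    have hgQ : ∀ᶠ r in nhds 0, g (pairRot η η' r - Hr ν σ) ≠ 0 :=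
      ContinuousAt.eventually_ne (hgc.continuousAt.comp (hQc.sub continuousAt_const))
        (by simpa [hQ0] using hηg)
    filter_upwards [hgQ, eventually_inner_pos (v := e) hQc (by rwa [hQ0]),
      eventually_inner_pos (v := e) (f := fun r => pairRot η η' r - (η - η'))
        (hQc.sub continuousAt_const) (by rwa [hQ0, sub_sub_cancel])] with r r1 r2 r3
    have := fderiv_cross_coupling hk hν hg hb ⟨norm_pairRot hk.le hηk hη'k r, r2⟩ hσ
      ⟨norm_pairRot_sub hk.le hηk hη'k r, r3⟩ hσ' (by rw [hδ]; abel) r1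
    simpa only [crossLogDeriv_apply, tripleL_apply] using this)
  rw [crossLogDeriv_apply] at hF
  exact (div_eq_zero_iff.1 hF).resolve_right (hb σ hσ).1

end Transport

theorem fderiv_apply_self_eq_zero {E F : Type*} [NormedAddCommGroup E] [NormedSpace ℝ E]
    [NormedAddCommGroup F] [NormedSpace ℝ F] {b : E → F} {x : E} (hb : DifferentiableAt ℝ b x)
    (h : ∀ᶠ t : ℝ in nhds 1, b (t • x) = b x) : fderiv ℝ b x x = 0 := by
  have h1 : HasDerivAt (fun t : ℝ => t • x) x 1 := by
    simpa using (hasDerivAt_id (1 : ℝ)).smul_const x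
  have h2 : HasFDerivAt b (fderiv ℝ b x) ((1 : ℝ) • x) := by
    rw [one_smul]; exact hb.hasFDerivAt
  exact (h2.comp_hasDerivAt 1 h1).unique ((hasDerivAt_const 1 (b x)).congr_of_eventuallyEq h)

theorem exists_eq_mul_inner_proj {σ ν : Euc 3} (hσ : σ ≠ 0) (hc : cross3 σ ν ≠ 0)
    (L : Euc 3 →ₗ[ℝ] ℂ) (h1 : L σ = 0) (h2 : L (cross3 ν σ) = 0) :
    ∃ c : ℂ, ∀ x : Euc 3, L x = c * ((⟪ν - (⟪ν, σ⟫ / ‖σ‖ ^ 2) • σ, x⟫ : ℝ) : ℂ) := by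
  have hT : ⟪ν, ν⟫ * ⟪σ, σ⟫ - ⟪ν, σ⟫ ^ 2 ≠ 0 := by
    have := inner_cross3_cross3 σ ν σ ν
    rw [real_inner_self_eq_norm_sq] at this
    have h0 : ‖cross3 σ ν‖ ^ 2 ≠ 0 := by positivity
    rw [this, real_inner_comm ν σ] at h0
    intro h; apply h0; linear_combination h
  have hσσ : ⟪σ, σ⟫ ≠ 0 := by simpa using hσ
  generalize hTd : ⟪ν, ν⟫ * ⟪σ, σ⟫ - ⟪ν, σ⟫ ^ 2 = T at *
  refine ⟨L (⟪σ, σ⟫ • ν - ⟪ν, σ⟫ • σ) / T, fun x => ?_⟩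
  have hx := congrArg L (orthogonal_frame_expansion σ ν x)
  rw [hTd] at hx
  have hp : ⟪σ, σ⟫ • ν - ⟪ν, σ⟫ • σ = ⟪σ, σ⟫ • (ν - (⟪ν, σ⟫ / ‖σ‖ ^ 2) • σ) := by
    rw [← real_inner_self_eq_norm_sq, smul_sub, smul_smul, mul_div_cancel₀ _ hσσ]
  generalize ⟪σ, σ⟫ • ν - ⟪ν, σ⟫ • σ = P at *
  simp only [map_add, map_smul, h1, h2, smul_zero, zero_add, add_zero, Complex.real_smul] at hx
  rw [hp, inner_smul_right, ← hp] at hx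
  push_cast at hx
  have hT' : (T : ℂ) ≠ 0 := by exact_mod_cast hT
  have hσ' : ((⟪σ, σ⟫ : ℝ) : ℂ) ≠ 0 := by exact_mod_cast hσσ
  apply mul_left_cancel₀ (mul_ne_zero hσ' hT')
  rw [hx, real_inner_comm x]
  field_simp

theorem exists_ne_zero_inner_eq_zero (ν : Euc 3) : ∃ v : Euc 3, v ≠ 0 ∧ ⟪ν, v⟫ = 0 := by
  by_cases h : ν 0 = 0
  · exact ⟨!₂[1, 0, 0], fun h0 => by simpa using congrArg (· 0) h0, by
      rw [inner_euc3]; simp [h]⟩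
  · exact ⟨!₂[ν 1, -ν 0, 0], fun h0 => h (by simpa using congrArg (· 1) h0), by
      rw [inner_euc3]; simp; ring⟩

theorem cross3_ne_zero_of_inner_ne_zero {σ ν v : Euc 3} (hν : ν ≠ 0) (hv : ⟪ν, v⟫ = 0)
    (h : ⟪σ, v⟫ ≠ 0) : cross3 σ ν ≠ 0 := by
  intro h0
  have := inner_cross3_cross3 σ ν v ν
  rw [h0, inner_zero_left, hv, mul_zero, sub_zero] at this
  exact mul_ne_zero h (inner_self_ne_zero.2 hν) this.symm

/-- in dimension 3, every continuous solution vanishes on `Y1 ∪ Y2`. -/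
theorem stmt14 (k0 : ℝ) (hk0 : 0 < k0)
    (ν ω : Euc 3) (hν : ‖ν‖ = 1) (hω : ‖ω‖ = 1)
    (χ : ℝ) (hχ : χ ∈ Set.Ioo (0 : ℝ) 1)
    (b : Euc 3 → ℂ) (hb : BHyp k0 χ ν ω b)
    (hb2 : ContDiffOn ℝ 2 b (Sig2chi k0 χ ν ω))
    (hdense : Sig2 k0 ν ω ⊆ closure {σ | σ ∈ Sig2 k0 ν ω ∧
      ¬∃ c : ℂ, ∀ x : Euc 3,
        fderiv ℝ b σ x = c * ((⟪ν - (⟪ν, σ⟫ / ‖σ‖ ^ 2) • σ, x⟫ : ℝ) : ℂ)})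
    (g : Euc 3 → ℂ) (hgc : Continuous g) (hg : SolvesHom k0 ν ω e3 b g) :
    ∀ y ∈ Y1set k0 ν ω e3 ∪ Y2set k0 ν ω e3, g y = 0 := by
  rintro y (⟨η, hη, σ, hσ, rfl⟩ | ⟨η, hη, σ₀, hσ₀, rfl⟩)
  · exact (hg η hη).1 σ hσ
  by_contra hne
  have hbd : ∀ σ ∈ Sig2 k0 ν ω, b σ ≠ 0 ∧ DifferentiableAt ℝ b σ := fun σ hσ =>
    ⟨hb.1 σ ⟨σ, hσ, 1, ⟨by linarith [hχ.1], by linarith [hχ.1]⟩, (one_smul ℝ σ).symm⟩,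
      (hb2.contDiffAt (Sig2chi_mem_nhds hν hk0 hχ hσ)).differentiableAt (by norm_num)⟩
  have hg₀ : g (η - Hr ν σ₀) ≠ 0 := by
    rw [eq_neg_of_add_eq_zero_right ((hg η hη).2 σ₀ hσ₀)]
    exact neg_ne_zero.2 (mul_ne_zero (hbd σ₀ hσ₀).1 hne)
  have hν0 : ν ≠ 0 := by rintro rfl; simp at hν
  obtain ⟨v, hv, hνv⟩ := exists_ne_zero_inner_eq_zero ν
  have hH := continuous_Hr (ν := ν)
  have hU : IsOpen {x | 0 < ⟪x, ω⟫ ∧ 0 < ⟪Hr ν x, ω⟫ ∧ g (η - Hr ν x) ≠ 0} :=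
    (isOpen_lt continuous_const (by fun_prop : Continuous fun x : Euc 3 => ⟪x, ω⟫)).inter
      ((isOpen_lt continuous_const (by fun_prop : Continuous fun x : Euc 3 => ⟪Hr ν x, ω⟫)).inter
        (isOpen_ne_fun (f := fun x => g (η - Hr ν x)) (by fun_prop) continuous_const))
  have hne_open : ∀ w : Euc 3, IsOpen {x : Euc 3 | ⟪x, w⟫ ≠ 0} := fun w =>
    isOpen_ne_fun (by fun_prop) continuous_const
  obtain ⟨h1, h2, h3⟩ := (mem_Sig2_iff hν).1 hσ₀
  obtain ⟨σ₁, hσ₁U, hσ₁k, hσ₁⟩ :=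
    exists_mem_sphere_inner_ne_zero hk0 h1 hν0 (hU.mem_nhds ⟨h2, h3, hg₀⟩)
  obtain ⟨σ₂, ⟨hσ₂U, hσ₂⟩, hσ₂k, hσ₂v⟩ := exists_mem_sphere_inner_ne_zero hk0 hσ₁k hv
    ((hU.inter (hne_open ν)).mem_nhds ⟨hσ₁U, hσ₁⟩)
  obtain ⟨σ, ⟨⟨hσU, hσν⟩, hσv⟩, hσ, hσb⟩ := mem_closure_iff.1
    (hdense ((mem_Sig2_iff hν).2 ⟨hσ₂k, hσ₂U.1, hσ₂U.2.1⟩)) _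
    ((hU.inter (hne_open ν)).inter (hne_open v)) ⟨⟨hσ₂U, hσ₂⟩, hσ₂v⟩
  have hc := cross3_ne_zero_of_inner_ne_zero hν0 hνv hσv
  refine hσb (exists_eq_mul_inner_proj (by rintro rfl; simp at hσv) hc
    (fderiv ℝ b σ).toLinearMap (fderiv_apply_self_eq_zero (hbd σ hσ).2 ?_)
    (fderiv_cross_normal_eq_zero hk0 hν hg hgc hbd hη hσ hσν hc hσU.2.2))
  filter_upwards [Ioo_mem_nhds (by linarith [hχ.1] : 1 - χ < 1)
    (by linarith [hχ.1] : 1 < 1 + χ)] with t ht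
  exact hb.2 σ hσ t ht
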